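/- Let Y be a complete Busemann convex geodesic space that is weakly uniformly convex and satisfies condition (1). Let (X,μ), T, w, D ⊆ Y, y ∈ D and a_n be as in the cocycle setting, and let A = lim_{n→∞} (1/n)∫_X d(y, a_n(x)y) dμ(x). If A > 0, then for μ-almost every x ∈ X there exists a unique geodesic ray γ : [0,∞) → Y with γ(0) = y (depending on x) such that lim_{n→∞} (1/n)·d(γ(A·n), a_n(x)y) = 0. -/

import Mathlib

open Set Filter MeasureTheory

/-- A geodesic path of length `l`: an isometric map from `[0, l] ⊆ ℝ` into `Y`. -/
def IsGeodesicPath {Y : Type*} [MetricSpace Y] (l : ℝ) (γ : ℝ → Y) : Prop :=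
  ∀ s ∈ Set.Icc (0:ℝ) l, ∀ t ∈ Set.Icc (0:ℝ) l, dist (γ s) (γ t) = |s - t|

/-- A geodesic path joining `x` to `y`, parametrized on `[0, dist x y]`. -/
def IsGeodesicFromTo {Y : Type*} [MetricSpace Y] (x y : Y) (γ : ℝ → Y) : Prop :=
  IsGeodesicPath (dist x y) γ ∧ γ 0 = x ∧ γ (dist x y) = y

/-- A geodesic space: every two points are joined by a geodesic path. -/
def GeodesicSpace (Y : Type*) [MetricSpace Y] : Prop :=
  ∀ x y : Y, ∃ γ : ℝ → Y, IsGeodesicFromTo x y γ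

/-- `m` is a midpoint of a geodesic segment from `x` to `y`. -/
def IsMidpointOf {Y : Type*} [MetricSpace Y] (x y m : Y) : Prop :=
  ∃ γ : ℝ → Y, IsGeodesicFromTo x y γ ∧ γ (dist x y / 2) = m

/-- `p` belongs to a geodesic segment `[x, y]`. -/
def OnGeodesicSegment {Y : Type*} [MetricSpace Y] (x y p : Y) : Prop :=
  ∃ γ : ℝ → Y, IsGeodesicFromTo x y γ ∧ ∃ t ∈ Set.Icc (0:ℝ) (dist x y), γ t = p

/-- The modulus of convexity `δ_Y(a, r, ε)` (infimum over the empty set taken to be `1`). -/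
noncomputable def convMod (Y : Type*) [MetricSpace Y] (a : Y) (r ε : ℝ) : ℝ :=
  sInf ({1} ∪ {u : ℝ | ∃ x y m : Y, dist a x ≤ r ∧ dist a y ≤ r ∧ ε * r ≤ dist x y ∧
    IsMidpointOf x y m ∧ u = 1 - dist a m / r})

/-- `Y` is weakly uniformly convex: `δ_Y(a, r, ε) > 0` for all `a ∈ Y`, `r > 0`, `ε ∈ (0, 2]`. -/
def WeaklyUniformlyConvex (Y : Type*) [MetricSpace Y] : Prop :=
  ∀ (a : Y) (r ε : ℝ), 0 < r → ε ∈ Set.Ioc (0:ℝ) 2 → 0 < convMod Y a r ε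

/-- Condition (1): for every `a ∈ Y`, `ε > 0` there is `s > 0` with `inf_{r ≥ s} δ_Y(a,r,ε) > 0`. -/
def CondOne (Y : Type*) [MetricSpace Y] : Prop :=
  ∀ (a : Y) (ε : ℝ), 0 < ε → ∃ s > (0:ℝ), 0 < sInf {u : ℝ | ∃ r ≥ s, u = convMod Y a r ε}

/-- Busemann convexity. -/
def BusemannConvex (Y : Type*) [MetricSpace Y] : Prop :=
  ∀ (l₁ l₂ : ℝ) (γ₁ γ₂ : ℝ → Y), 0 ≤ l₁ → 0 ≤ l₂ →
    IsGeodesicPath l₁ γ₁ → IsGeodesicPath l₂ γ₂ → γ₁ 0 = γ₂ 0 →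
    ∀ t ∈ Set.Icc (0:ℝ) 1, dist (γ₁ (t * l₁)) (γ₂ (t * l₂)) ≤ t * dist (γ₁ l₁) (γ₂ l₂)

/-- A geodesic ray: an isometric map from `[0, ∞)` into `Y`. -/
def IsGeodesicRay {Y : Type*} [MetricSpace Y] (γ : ℝ → Y) : Prop :=
  ∀ s t : ℝ, 0 ≤ s → 0 ≤ t → dist (γ s) (γ t) = |s - t|

noncomputable def kmG {X : Type*} (T : X → X) (g : ℕ → X → ℝ) : ℕ → X → ℝ
  | 0 => fun _ => 0
  | n + 1 => fun x => g (n + 1) x + kmG T g n (T x)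

lemma kmG_nonneg {X : Type*} (T : X → X) (g : ℕ → X → ℝ) (hg : ∀ n x, 0 ≤ g n x) (n : ℕ) :
    ∀ x, 0 ≤ kmG T g n x := by
  induction n with
  | zero => intro x; simp [kmG]
  | succ n ih => intro x; exact add_nonneg (hg _ _) (ih _)

lemma kmG_shift {X : Type*} (T : X → X) (g : ℕ → X → ℝ) (hg : ∀ n x, 0 ≤ g n x) (k : ℕ) :
    ∀ n x, k ≤ n → kmG T g (n - k) (T^[k] x) ≤ kmG T g n x := by
  induction k with
  | zero => intro n x _; simp
  | succ k ih =>
    intro n x hk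
    obtain ⟨m, rfl⟩ : ∃ m, n = m + 1 := ⟨n - 1, by omega⟩
    have := ih m (T x) (by omega)
    rw [Function.iterate_succ_apply, Nat.add_sub_add_right]
    refine this.trans ?_
    simp only [kmG]
    linarith [hg (m + 1) x]

lemma kmG_integral {X : Type*} [MeasurableSpace X] (μ : Measure X)
    (T : X → X) (hT : MeasurePreserving T μ μ) (g : ℕ → X → ℝ) (hg : ∀ n, Integrable (g n) μ)
    (n : ℕ) : Integrable (kmG T g n) μ ∧
      ∫ x, kmG T g n x ∂μ = ∑ i ∈ Finset.range n, ∫ x, g (i + 1) x ∂μ := by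
  induction n with
  | zero => simp [kmG]
  | succ n ih =>
    have h1 : Integrable (fun x => kmG T g n (T x)) μ := hT.integrable_comp_of_integrable ih.1
    have h2 : ∫ x, kmG T g n (T x) ∂μ = ∫ x, kmG T g n x ∂μ := by
      have h3 := hT.map_eq
      conv_rhs => rw [← h3]
      rw [integral_map hT.measurable.aemeasurable]
      rw [h3]; exact ih.1.aestronglyMeasurable
    refine ⟨(hg _).add h1, ?_⟩
    simp only [kmG]
    rw [integral_add (hg _) h1, h2, ih.2, Finset.sum_range_succ, add_comm]

lemma km_meas {X : Type*} [MeasurableSpace X] (T : X → X) (hT : Measurable T) (b : ℕ → X → ℝ)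
    (hbm : ∀ n, Measurable (b n)) (c : ℝ) (K n : ℕ) :
    MeasurableSet {x | ∀ k, K ≤ k → k ≤ n → c * k ≤ b n x - b (n - k) (T^[k] x)} := by
  simp only [Set.ofPred_forall]
  refine MeasurableSet.iInter fun k => MeasurableSet.iInter fun _ => MeasurableSet.iInter fun _ => ?_
  exact measurableSet_le measurable_const ((hbm n).sub ((hbm _).comp (hT.iterate k)))

lemma km_pos {X : Type*} [MeasurableSpace X] (μ : Measure X) [IsProbabilityMeasure μ]
    (T : X → X) (hT : MeasurePreserving T μ μ) (b : ℕ → X → ℝ)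
    (hbm : ∀ n, Measurable (b n)) (hbi : ∀ n, Integrable (b n) μ) (hb0 : ∀ x, b 0 x = 0)
    (hsub : ∀ n x, b (n + 1) x ≤ b 1 x + b n (T x)) (η : ℝ) (hη : 0 < η)
    (h : ∀ᶠ n : ℕ in atTop, η * n ≤ ∫ x, b n x ∂μ) :
    ¬ ∀ᵐ x ∂μ, ¬ ∃ᶠ n in atTop, ∀ k ≤ n, b (n - k) (T^[k] x) ≤ b n x := by
  intro hae
  classical
  set Φ : ℕ → Set X := fun n => {x | ∀ k ≤ n, b (n - k) (T^[k] x) ≤ b n x} with hΦ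
  have hΦm : ∀ n, MeasurableSet (Φ n) := by
    intro n
    have := km_meas T hT.measurable b hbm 0 0 n
    simpa [hΦ] using this
  set fp : X → ℝ := fun x => max (b 1 x) 0 with hfp
  have hfpi : Integrable fp μ := (hbi 1).pos_part
  set g : ℕ → X → ℝ := fun n => (Φ n).indicator fp with hg
  have hgi : ∀ n, Integrable (g n) μ := fun n => hfpi.indicator (hΦm n)
  have hg0 : ∀ n x, 0 ≤ g n x := fun n x => Set.indicator_nonneg (fun _ _ => le_max_right _ _) x
  have key : ∀ n x, b n x ≤ kmG T g n x := by
    intro n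
    induction n using Nat.strong_induction_on with
    | _ n ih =>
      intro x
      by_cases hx : x ∈ Φ n
      · rcases n with _ | n
        · simp [hb0, kmG]
        · have h1 := ih n (by omega) (T x)
          have h2 : g (n + 1) x = max (b 1 x) 0 := Set.indicator_of_mem hx _
          have h3 := le_max_left (b 1 x) 0
          have h4 := hsub n x
          simp only [kmG]
          linarith
      · simp only [hΦ, Set.mem_ofPred_eq, not_forall, not_le] at hx
        obtain ⟨k, hk, hlt⟩ := hx
        have hk0 : k ≠ 0 := by rintro rfl; simp at hlt
        have h1 := ih (n - k) (by omega) (T^[k] x)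
        have h2 := kmG_shift T g hg0 k n x hk
        linarith
  have hlim : Tendsto (fun n => ∫ x, g n x ∂μ) atTop (nhds (∫ _, (0:ℝ) ∂μ)) := by
    refine tendsto_integral_of_dominated_convergence fp (fun n => (hgi n).aestronglyMeasurable)
      hfpi ?_ ?_
    · intro n
      refine Eventually.of_forall fun x => ?_
      rw [Real.norm_of_nonneg (hg0 n x)]
      exact Set.indicator_le_self' (fun _ _ => le_max_right _ _) x
    · filter_upwards [hae] with x hx
      rw [not_frequently] at hx
      refine tendsto_const_nhds.congr' ?_
      filter_upwards [hx] with n hn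
      exact (Set.indicator_of_notMem (by simpa [hΦ] using hn) _).symm
  rw [integral_zero] at hlim
  have hc := ((tendsto_add_atTop_iff_nat 1).2 hlim).cesaro
  have hev := hc.eventually (gt_mem_nhds hη)
  obtain ⟨n, h1, h2, h3⟩ := (h.and (hev.and (eventually_gt_atTop 0))).exists
  have h4 := kmG_integral μ T hT g hgi n
  have h5 : ∫ x, b n x ∂μ ≤ ∫ x, kmG T g n x ∂μ := integral_mono (hbi n) h4.1 (key n)
  rw [h4.2] at h5
  have hn : (0:ℝ) < n := by exact_mod_cast h3
  rw [inv_mul_lt_iff₀ hn] at h2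
  linarith

lemma km_erg {X : Type*} [MeasurableSpace X] (μ : Measure X) [IsProbabilityMeasure μ]
    (T : X → X) (hT : Ergodic T μ) (b : ℕ → X → ℝ)
    (hbm : ∀ n, Measurable (b n)) (hbi : ∀ n, Integrable (b n) μ) (hb0 : ∀ x, b 0 x = 0)
    (hsub : ∀ n x, b (n + 1) x ≤ b 1 x + b n (T x)) (c c0 : ℝ) (hc : c < c0)
    (h : ∀ᶠ n : ℕ in atTop, c0 * n ≤ ∫ x, b n x ∂μ) :
    ∀ᵐ x ∂μ, ∃ K : ℕ, ∃ᶠ n in atTop, ∀ k : ℕ, K ≤ k → k ≤ n →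
      c * k ≤ b n x - b (n - k) (T^[k] x) := by
  set d : ℕ → ℝ := fun N => c + 1 / ((N:ℝ) + 1) with hd
  set E : Set X := {x | ∃ N K : ℕ, ∃ᶠ n in atTop, ∀ k : ℕ, K ≤ k → k ≤ n →
      d N * k ≤ b n x - b (n - k) (T^[k] x)} with hE
  have hEm : MeasurableSet E := by
    have : E = ⋃ N : ℕ, ⋃ K : ℕ, ⋂ m : ℕ, ⋃ n : ℕ, ⋃ _ : n ≥ m,
        {x | ∀ k : ℕ, K ≤ k → k ≤ n → d N * k ≤ b n x - b (n - k) (T^[k] x)} := by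
      ext x; simp [hE, frequently_atTop]
    rw [this]
    refine MeasurableSet.iUnion fun N => MeasurableSet.iUnion fun K => ?_
    exact MeasurableSet.iInter fun m => MeasurableSet.iUnion fun n => MeasurableSet.iUnion fun _ =>
      km_meas T hT.measurable b hbm _ _ _
  have hinv : E ⊆ T ⁻¹' E := by
    rintro x ⟨N, K, hx⟩
    have hlt : d (N + 1) < d N := by
      simp only [hd]
      have : (0:ℝ) < (N:ℝ) + 1 := by positivity
      gcongr
      push_cast; linarith
    obtain ⟨K', hK'⟩ := exists_nat_ge ((b 1 x + |d N|) / (d N - d (N + 1)))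
    rw [div_le_iff₀ (by linarith)] at hK'
    refine ⟨N + 1, max K K', ?_⟩
    rw [frequently_atTop] at hx ⊢
    intro m
    obtain ⟨n, hn, hx⟩ := hx (m + 1)
    obtain ⟨n, rfl⟩ : ∃ j, n = j + 1 := ⟨n - 1, by omega⟩
    refine ⟨n, by omega, fun k hk hkn => ?_⟩
    have h1 := hx (k + 1) (by have := le_max_left K K'; omega) (by omega)
    rw [Nat.add_sub_add_right, Function.iterate_succ_apply] at h1
    have h2 := hsub n x
    have h3 : (K':ℝ) ≤ k := by exact_mod_cast (le_max_right K K').trans hk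
    push_cast at h1
    have h4 := neg_abs_le (d N)
    have h5 : (K':ℝ) * (d N - d (N+1)) ≤ k * (d N - d (N+1)) := by
      apply mul_le_mul_of_nonneg_right h3; linarith
    nlinarith
  have hcase := hT.ae_empty_or_univ_of_ae_le_preimage hEm.nullMeasurableSet
    (LE.le.eventuallyLE hinv)
  have hfull : ∀ᵐ x ∂μ, x ∈ E := by
    rcases hcase with h0 | h0
    · exfalso
      obtain ⟨N, hN⟩ := exists_nat_one_div_lt (sub_pos.2 hc)
      have hdN : d N < c0 := by simp only [hd]; linarith
      refine km_pos μ T hT.toMeasurePreserving (fun n x => b n x - d N * n)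
        (fun n => (hbm n).sub_const _) (fun n => (hbi n).sub (integrable_const _))
        (by intro x; simp [hb0]) ?_ (c0 - d N) (by linarith) ?_ ?_
      · intro n x
        have := hsub n x
        push_cast; linarith
      · filter_upwards [h] with n hn
        rw [integral_sub (hbi n) (integrable_const _)]
        simp only [integral_const, probReal_univ, one_smul]
        linarith
      · filter_upwards [h0] with x hx hfr
        have : x ∈ E := by
          refine ⟨N, 0, hfr.mono ?_⟩
          intro n hn k _ hk
          have := hn k hk
          rw [Nat.cast_sub hk] at this
          linarith
        have h9 : E x := this
        rw [hx] at h9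
        exact h9
    · filter_upwards [h0] with x hx
      have : (univ : Set X) x := trivial
      rw [← hx] at this
      exact this
  filter_upwards [hfull] with x hx
  obtain ⟨N, K, hx⟩ := hx
  refine ⟨K, hx.mono ?_⟩
  intro n hn k h1 h2
  refine le_trans ?_ (hn k h1 h2)
  apply mul_le_mul_of_nonneg_right _ (Nat.cast_nonneg k)
  simp only [hd]
  have : (0:ℝ) < 1 / ((N:ℝ) + 1) := by positivity
  linarith

lemma km_int_iter {X : Type*} [MeasurableSpace X] (μ : Measure X)
    (T : X → X) (hT : MeasurePreserving T μ μ) (f : X → ℝ)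
    (hf : Integrable f μ) (n : ℕ) :
    Integrable (birkhoffSum T f n) μ ∧ ∫ x, birkhoffSum T f n x ∂μ = n * ∫ x, f x ∂μ := by
  have hb : birkhoffSum T f n = fun x => kmG T (fun _ => f) n x := by
    funext x
    induction n generalizing x with
    | zero => simp [kmG]
    | succ n ih => rw [birkhoffSum_succ', ih]; rfl
  have := kmG_integral μ T hT (fun _ => f) (fun _ => hf) n
  rw [hb]
  refine ⟨this.1, this.2.trans (by simp)⟩

lemma km_bs_meas {X : Type*} [MeasurableSpace X]
    (T : X → X) (hT : Measurable T) (f : X → ℝ)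
    (hf : Measurable f) (n : ℕ) : Measurable (birkhoffSum T f n) := by
  unfold birkhoffSum
  exact Finset.measurable_fun_sum _ fun k _ => hf.comp (hT.iterate k)

lemma km_birk_low {X : Type*} [MeasurableSpace X] (μ : Measure X) [IsProbabilityMeasure μ]
    (T : X → X) (hT : Ergodic T μ) (f : X → ℝ) (hfm : Measurable f) (hf : Integrable f μ)
    (c : ℝ) (hc : c < ∫ x, f x ∂μ) :
    ∀ᵐ x ∂μ, ∀ᶠ n : ℕ in atTop, c * n ≤ birkhoffSum T f n x := by
  have := km_erg μ T hT (birkhoffSum T f) (km_bs_meas T hT.measurable f hfm)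
    (fun n => (km_int_iter μ T hT.toMeasurePreserving f hf n).1) (by simp)
    (by intro n x; rw [birkhoffSum_succ', birkhoffSum_one]) c _ hc
    (Eventually.of_forall fun n => by
      rw [(km_int_iter μ T hT.toMeasurePreserving f hf n).2, mul_comm])
  filter_upwards [this] with x hx
  obtain ⟨K, hx⟩ := hx
  filter_upwards [eventually_ge_atTop K] with k hk
  obtain ⟨n, hn, h2⟩ := (frequently_atTop.1 hx) k
  have h3 := h2 k hk hn
  have h4 := birkhoffSum_add T f k (n - k) x
  rw [Nat.add_sub_cancel' hn] at h4
  linarith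

lemma km_birk_up {X : Type*} [MeasurableSpace X] (μ : Measure X) [IsProbabilityMeasure μ]
    (T : X → X) (hT : Ergodic T μ) (f : X → ℝ) (hfm : Measurable f) (hf : Integrable f μ)
    (c : ℝ) (hc : ∫ x, f x ∂μ < c) :
    ∀ᵐ x ∂μ, ∀ᶠ n : ℕ in atTop, birkhoffSum T f n x ≤ c * n := by
  have := km_birk_low μ T hT (-f) hfm.neg hf.neg (-c)
    (by simp only [Pi.neg_apply, integral_neg]; linarith)
  filter_upwards [this] with x hx
  filter_upwards [hx] with n hn
  rw [birkhoffSum_neg] at hn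
  linarith

lemma km_sub_le {X : Type*} (T : X → X) (a : ℕ → X → ℝ) (h0 : ∀ x, a 0 x = 0)
    (hsub : ∀ k j x, a (k + j) x ≤ a k x + a j (T^[k] x)) (m q : ℕ) :
    ∀ x, a (m * q) x ≤ birkhoffSum T^[m] (a m) q x := by
  induction q with
  | zero => intro x; simp [h0]
  | succ q ih =>
    intro x
    rw [birkhoffSum_succ', Nat.mul_succ, add_comm]
    exact (hsub m (m * q) x).trans (by linarith [ih (T^[m] x)])

lemma km_upper {X : Type*} [MeasurableSpace X] (μ : Measure X) [IsProbabilityMeasure μ]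
    (T : X → X) (hT : Ergodic T μ) (a : ℕ → X → ℝ)
    (ham : ∀ n, Measurable (a n)) (hai : ∀ n, Integrable (a n) μ) (h0 : ∀ x, a 0 x = 0)
    (hpos : ∀ n x, 0 ≤ a n x)
    (hsub : ∀ k j x, a (k + j) x ≤ a k x + a j (T^[k] x)) (A c : ℝ) (hAc : A < c) (hA0 : 0 ≤ A)
    (hA : Tendsto (fun n : ℕ => (∫ x, a n x ∂μ) / n) atTop (nhds A)) :
    ∀ᵐ x ∂μ, ∀ᶠ n : ℕ in atTop, a n x ≤ c * n := by
  set d : ℕ → ℝ := fun N => c - 1 / ((N:ℝ) + 1) with hd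
  set E : Set X := {x | ∃ N : ℕ, ∀ᶠ n : ℕ in atTop, a n x ≤ d N * n} with hE
  have hEm : MeasurableSet E := by
    have : E = ⋃ N : ℕ, ⋃ m : ℕ, ⋂ n : ℕ, ⋂ _ : n ≥ m, {x | a n x ≤ d N * n} := by
      ext x; simp [hE, eventually_atTop]
    rw [this]
    exact MeasurableSet.iUnion fun N => MeasurableSet.iUnion fun K => 
      MeasurableSet.iInter fun m => MeasurableSet.iInter fun n => 
        measurableSet_le (ham _) measurable_const
  have hinv : T ⁻¹' E ⊆ E := by
    rintro x ⟨N, hx⟩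
    have hlt : d N < d (N + 1) := by
      simp only [hd]
      have : (0:ℝ) < (N:ℝ) + 1 := by positivity
      gcongr
      push_cast; linarith
    refine ⟨N + 1, ?_⟩
    obtain ⟨K', hK'⟩ := exists_nat_ge ((a 1 x + |d (N + 1)|) / (d (N + 1) - d N))
    rw [div_le_iff₀ (by linarith)] at hK'
    obtain ⟨K, hK⟩ := eventually_atTop.1 hx
    rw [eventually_atTop]
    refine ⟨max K K' + 1, fun n hn => ?_⟩
    obtain ⟨n, rfl⟩ : ∃ j, n = j + 1 := ⟨n - 1, by omega⟩
    have h1 := hK n (by have := le_max_left K K'; omega)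
    have h2 := hsub 1 n x
    rw [add_comm 1 n, Function.iterate_one] at h2
    have h3 : (K':ℝ) ≤ n := by
      have := le_max_right K K'
      exact_mod_cast (by omega : K' ≤ n)
    have h4 := neg_abs_le (d (N + 1))
    have h5 : (K':ℝ) * (d (N + 1) - d N) ≤ n * (d (N + 1) - d N) := by
      apply mul_le_mul_of_nonneg_right h3; linarith
    push_cast
    nlinarith
  have hcase := hT.ae_empty_or_univ_of_preimage_ae_le hEm.nullMeasurableSet
    (LE.le.eventuallyLE hinv)
  have hfull : ∀ᵐ x ∂μ, x ∈ E := by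
    rcases hcase with hem | h1
    · exfalso
      obtain ⟨N, hN⟩ := exists_nat_one_div_lt (sub_pos.2 hAc)
      have hdN : A < d N := by simp only [hd]; linarith
      obtain ⟨c1, hc1, hc2⟩ := exists_between hdN
      obtain ⟨m, hm1, hm0⟩ := ((hA.eventually (gt_mem_nhds hc1)).and (eventually_gt_atTop 0)).exists
      have hm0' : (0:ℝ) < m := by exact_mod_cast hm0
      rw [div_lt_iff₀ hm0'] at hm1
      set F := ∫ x, a 1 x ∂μ with hF
      have hF0 : 0 ≤ F := integral_nonneg (hpos 1)
      set θ := (d N - c1) / 4 with hθ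
      have hθ0 : 0 < θ := by simp only [hθ]; linarith
      have hup := km_birk_up μ T hT (a 1) (ham 1) (hai 1) (F + θ) (by linarith)
      have hlo := km_birk_low μ T hT (a 1) (ham 1) (hai 1) (F - θ) (by linarith)
      have hTm := hT.toMeasurePreserving.iterate m
      have hbi := km_int_iter μ T^[m] hTm (a m) (hai m)
      refine km_pos μ T^[m] hTm (fun k x => c1 * m * k - birkhoffSum T^[m] (a m) k x)
        (fun n => measurable_const.sub (km_bs_meas _ hTm.measurable _ (ham m) n))
        (fun n => (integrable_const _).sub (hbi n).1)
        (by intro x; simp) ?_ (c1 * m - ∫ x, a m x ∂μ) (by linarith) ?_ ?_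
      · intro n x
        rw [birkhoffSum_succ', birkhoffSum_one]
        push_cast; linarith
      · refine Eventually.of_forall fun n => ?_
        rw [integral_sub (integrable_const _) (hbi n).1, (hbi n).2]
        simp only [integral_const, probReal_univ, one_smul]
        linarith
      · filter_upwards [hem, hup, hlo] with x hx hup hlo hfr
        have hmul : ∀ q : ℕ, a (m * q) x ≤ c1 * m * q := by
          intro q
          obtain ⟨n, hn, h2⟩ := (frequently_atTop.1 hfr) q
          have h3 := h2 q hn
          have h4 := birkhoffSum_add T^[m] (a m) q (n - q) x
          rw [Nat.add_sub_cancel' hn] at h4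
          rw [Nat.cast_sub hn] at h3
          have h5 := km_sub_le T a h0 hsub m q x
          linarith
        have : x ∈ E := by
          refine ⟨N, ?_⟩
          obtain ⟨K1, hK1⟩ := eventually_atTop.1 hup
          obtain ⟨K2, hK2⟩ := eventually_atTop.1 hlo
          obtain ⟨K3, hK3⟩ := exists_nat_ge (F * m / θ)
          rw [div_le_iff₀ hθ0] at hK3
          filter_upwards [eventually_ge_atTop (K1 + K2 + K3 + m)] with n hn
          obtain ⟨q, r, hr, hnq⟩ : ∃ q r, r < m ∧ n = m * q + r :=
            ⟨n / m, n % m, Nat.mod_lt _ hm0, (Nat.div_add_mod n m).symm⟩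
          have e1 := hK1 n (by omega)
          have e2 := hK2 (m * q) (by omega)
          have e3 := hmul q
          have e4 := hsub (m * q) r x
          have e5 := km_sub_le T a h0 hsub 1 r (T^[m * q] x)
          rw [one_mul, Function.iterate_one] at e5
          have e6 := birkhoffSum_add T (a 1) (m * q) r x
          rw [← hnq] at e6 e4
          have e7 : (n:ℝ) = m * q + r := by exact_mod_cast hnq
          have e8 : (K3:ℝ) ≤ n := by exact_mod_cast (by omega : K3 ≤ n)
          have e9 : (r:ℝ) ≤ m := by exact_mod_cast hr.le
          have e10 : F * r ≤ F * m := mul_le_mul_of_nonneg_left e9 hF0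
          have e11 : K3 * θ ≤ n * θ := mul_le_mul_of_nonneg_right e8 hθ0.le
          have e12 : (0:ℝ) ≤ c1 * r := mul_nonneg (by linarith) (Nat.cast_nonneg r)
          have e13 : 0 ≤ θ * r := by positivity
          have e14 : d N = c1 + 4 * θ := by simp only [hθ]; ring
          push_cast at e2
          rw [e14]
          have e15 : (m:ℝ) * q = n - r := by linarith
          rw [e15] at e2
          rw [mul_assoc, e15] at e3
          have e16 : 0 ≤ θ * n := by positivity
          nlinarith
        have h9 : E x := this
        rw [hx] at h9
        exact h9
    · filter_upwards [h1] with x hx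
      have : (univ : Set X) x := trivial
      rw [← hx] at this
      exact this
  filter_upwards [hfull] with x hx
  obtain ⟨N, hx⟩ := hx
  filter_upwards [hx] with n hn
  refine hn.trans ?_
  apply mul_le_mul_of_nonneg_right _ (Nat.cast_nonneg n)
  simp only [hd]
  have : (0:ℝ) < 1 / ((N:ℝ) + 1) := by positivity
  linarith

lemma mid_dist {Y : Type*} [MetricSpace Y] {x x' m : Y} (h : IsMidpointOf x x' m) :
    dist x m = dist x x' / 2 ∧ dist m x' = dist x x' / 2 := by
  obtain ⟨γ, ⟨h1, h2, h3⟩, h4⟩ := h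
  have hd : 0 ≤ dist x x' := dist_nonneg
  have e1 := h1 0 ⟨le_rfl, hd⟩ (dist x x' / 2) ⟨by linarith, by linarith⟩
  have e2 := h1 (dist x x' / 2) ⟨by linarith, by linarith⟩ (dist x x') ⟨hd, le_rfl⟩
  rw [h2, h4, zero_sub, abs_neg, abs_of_nonneg (by linarith)] at e1
  rw [h3, h4, abs_of_nonpos (by linarith)] at e2
  exact ⟨e1, by linarith⟩

lemma convMod_lb {Y : Type*} [MetricSpace Y] (a : Y) (r ε : ℝ) (hr : 0 < r) :
    ∀ u ∈ ({1} ∪ {u : ℝ | ∃ x y m : Y, dist a x ≤ r ∧ dist a y ≤ r ∧ ε * r ≤ dist x y ∧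
    IsMidpointOf x y m ∧ u = 1 - dist a m / r} : Set ℝ), -1 ≤ u := by
  rintro u (rfl | ⟨x, x', m, h1, h2, h3, h4, rfl⟩)
  · norm_num
  · have e := (mid_dist h4).1
    have t1 := dist_triangle a x m
    have t2 := dist_triangle_left x x' a
    have : dist a m / r ≤ 2 := by rw [div_le_iff₀ hr]; linarith
    linarith

lemma convMod_use {Y : Type*} [MetricSpace Y] (a : Y) (r ε : ℝ) (hr : 0 < r) {x x' m : Y}
    (h1 : dist a x ≤ r) (h2 : dist a x' ≤ r) (h3 : ε * r ≤ dist x x') (h4 : IsMidpointOf x x' m) :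
    dist a m ≤ (1 - convMod Y a r ε) * r := by
  have : convMod Y a r ε ≤ 1 - dist a m / r :=
    csInf_le ⟨-1, convMod_lb a r ε hr⟩ (Or.inr ⟨x, x', m, h1, h2, h3, h4, rfl⟩)
  have h5 : dist a m / r ≤ 1 - convMod Y a r ε := by linarith
  rwa [div_le_iff₀ hr] at h5

lemma condOne_use {Y : Type*} [MetricSpace Y] (h : CondOne Y) (a : Y) (ε : ℝ) (hε : 0 < ε) :
    ∃ s > (0:ℝ), ∃ c > (0:ℝ), ∀ r ≥ s, c ≤ convMod Y a r ε := by
  obtain ⟨s, hs, hc⟩ := h a ε hε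
  refine ⟨s, hs, _, hc, fun r hr => csInf_le ⟨-1, ?_⟩ ⟨r, hr, rfl⟩⟩
  rintro u ⟨r, hr, rfl⟩
  exact le_csInf ⟨1, Or.inl rfl⟩ (convMod_lb a r ε (lt_of_lt_of_le hs hr))

lemma mid_convex {Y : Type*} [MetricSpace Y] (hgeo : GeodesicSpace Y) (hbus : BusemannConvex Y)
    {x x' m p : Y} (h : IsMidpointOf x x' m) :
    dist m p ≤ dist x p / 2 + dist x' p / 2 := by
  obtain ⟨γ, ⟨h1, h2, h3⟩, h4⟩ := h
  obtain ⟨τ, g⟩ := hgeo x p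
  have hb := hbus (dist x x') (dist x p) γ τ dist_nonneg dist_nonneg h1 g.1 (h2.trans g.2.1.symm)
    (1/2) ⟨by norm_num, by norm_num⟩
  rw [h3, g.2.2] at hb
  have e := (mid_dist ⟨τ, g, rfl⟩ : _ ∧ _).2
  have e1 : 1 / 2 * dist x x' = dist x x' / 2 := by ring
  have e2 : 1 / 2 * dist x p = dist x p / 2 := by ring
  rw [e1, e2, h4] at hb
  have := dist_triangle m (τ (dist x p / 2)) p
  linarith

lemma geo_one {Y : Type*} [MetricSpace Y] (hgeo : GeodesicSpace Y) (hbus : BusemannConvex Y)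
    (hcond : CondOne Y) (y : Y) (z : ℕ → Y) (A : ℝ) (hA : 0 < A)
    (h1 : ∀ ε > (0:ℝ), ∀ᶠ k : ℕ in atTop, dist y (z k) ≤ (A + ε) * k)
    (h2 : ∀ ε > (0:ℝ), ∃ K : ℕ, ∃ᶠ n in atTop, ∀ k : ℕ, K ≤ k → k ≤ n →
      (A - ε) * k ≤ dist y (z n) - dist (z k) (z n))
    (σ : ℕ → ℝ → Y) (hσ : ∀ n, IsGeodesicFromTo y (z n) (σ n)) (η : ℝ) (hη : 0 < η) :
    ∃ ε, 0 < ε ∧ ε < η ∧ ε < A ∧ ∃ K : ℕ, ∃ᶠ n in atTop, ∀ k : ℕ, K ≤ k → k ≤ n →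
      (A - ε) * k ≤ dist y (z n) ∧ dist (z k) (σ n ((A - ε) * k)) ≤ η * k := by
  obtain ⟨s, hs, c, hc, hsc⟩ := condOne_use hcond y (η / (2 * A)) (by positivity)
  obtain ⟨ε, hε0, hε⟩ := exists_between (show 0 < min (min (η / 2) (A / 2)) (c * A / 4) by positivity)
  simp only [lt_min_iff] at hε
  obtain ⟨⟨hε1, hε2⟩, hε3⟩ := hε
  obtain ⟨K1, hK1⟩ := eventually_atTop.1 (h1 ε hε0)
  obtain ⟨K2, hK2⟩ := h2 ε hε0
  obtain ⟨K3, hK3⟩ := exists_nat_ge (s / A)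
  rw [div_le_iff₀ hA] at hK3
  refine ⟨ε, hε0, by linarith, by linarith, K1 + K2 + K3 + 1, hK2.mono fun n hn k hk hkn => ?_⟩
  have f1 := hK1 k (by omega)
  have f2 := hn k (by omega) hkn
  have hk0 : (0:ℝ) < k := by exact_mod_cast (by omega : 0 < k)
  have hk3 : (K3:ℝ) ≤ k := by exact_mod_cast (by omega : K3 ≤ k)
  have f3 : (A - ε) * k ≤ dist y (z n) := f2.trans (by linarith [dist_nonneg (x := z k) (y := z n)])
  refine ⟨f3, ?_⟩
  by_contra hcon
  push Not at hcon
  set r := (A + ε) * k with hr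
  have hAk : 0 ≤ (A - ε) * k := mul_nonneg (by linarith) hk0.le
  have hrs : s ≤ r := by
    have := mul_le_mul_of_nonneg_right hk3 hA.le
    simp only [hr]; nlinarith
  have hr0 : 0 < r := by linarith
  obtain ⟨g1, g2, g3⟩ := hσ n
  set q := σ n ((A - ε) * k) with hq
  have q1 : dist y q = (A - ε) * k := by
    have := g1 0 ⟨le_rfl, dist_nonneg⟩ _ ⟨hAk, f3⟩
    rwa [g2, zero_sub, abs_neg, abs_of_nonneg hAk] at this
  have q2 : dist q (z n) = dist y (z n) - (A - ε) * k := by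
    have := g1 _ ⟨hAk, f3⟩ _ ⟨dist_nonneg, le_rfl⟩
    rw [g3, abs_of_nonpos (by linarith)] at this
    rw [hq, this]; ring
  obtain ⟨τ, hτ⟩ := hgeo (z k) q
  have hm : IsMidpointOf (z k) q (τ (dist (z k) q / 2)) := ⟨τ, hτ, rfl⟩
  set m := τ (dist (z k) q / 2)
  have u1 := convMod_use y r (η / (2 * A)) hr0 f1 (by rw [q1, hr]; nlinarith) (by
    refine le_trans ?_ hcon.le
    rw [div_mul_eq_mul_div, div_le_iff₀ (by positivity), hr, mul_assoc]
    apply mul_le_mul_of_nonneg_left _ hη.le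
    nlinarith) hm
  have u2 := mid_convex hgeo hbus (p := z n) hm
  have u3 := dist_triangle y m (z n)
  have u4 : (1 - convMod Y y r (η / (2 * A))) * r ≤ (1 - c) * r :=
    mul_le_mul_of_nonneg_right (by linarith [hsc r hrs]) hr0.le
  have u5 : (A - ε) * k ≤ (1 - c) * r := by linarith
  have u6 : (A - ε) ≤ (1 - c) * (A + ε) := by
    rw [hr, ← mul_assoc] at u5
    exact le_of_mul_le_mul_right u5 hk0
  nlinarith [mul_pos hc hε0, mul_pos hc hA]

lemma geo_two {Y : Type*} [MetricSpace Y] (hbus : BusemannConvex Y)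
    (y : Y) (z : ℕ → Y) (A : ℝ) (hA : 0 < A)
    (σ : ℕ → ℝ → Y) (hσ : ∀ n, IsGeodesicFromTo y (z n) (σ n))
    (h1 : ∀ η > (0:ℝ), ∃ ε, 0 < ε ∧ ε < η ∧ ε < A ∧ ∃ K : ℕ, ∃ᶠ n in atTop, ∀ k : ℕ,
      K ≤ k → k ≤ n →
      (A - ε) * k ≤ dist y (z n) ∧ dist (z k) (σ n ((A - ε) * k)) ≤ η * k) (η : ℝ) (hη : 0 < η) :
    ∃ K : ℕ, 1 ≤ K ∧ ∀ k l : ℕ, K ≤ k → k ≤ l → 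
      dist (z k) (σ l (k / l * dist y (z l))) ≤ η * k ∧ (A - η) * k ≤ dist y (z k) := by
  obtain ⟨ε, e0, e1, e2, K, hK⟩ := h1 (η / 2) (by positivity)
  refine ⟨K + 1, by omega, fun k l hk hkl => ?_⟩
  obtain ⟨n, hnl, hn⟩ := frequently_atTop.1 hK l
  obtain ⟨a1, a2⟩ := hn k (by omega) (by omega)
  obtain ⟨b1, b2⟩ := hn l (by omega) (by omega)
  have hk0 : (0:ℝ) < k := by exact_mod_cast (by omega : 0 < k)
  have hl0 : (0:ℝ) < l := by exact_mod_cast (by omega : 0 < l)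
  have hkl' : (k:ℝ) ≤ l := by exact_mod_cast hkl
  have hAk : 0 ≤ (A - ε) * k := mul_nonneg (by linarith) hk0.le
  have hAl : 0 ≤ (A - ε) * l := mul_nonneg (by linarith) hl0.le
  obtain ⟨g1, g2, g3⟩ := hσ n
  obtain ⟨s1, s2, s3⟩ := hσ l
  constructor
  · have hb := hbus (dist y (z l)) ((A - ε) * l) (σ l) (σ n) dist_nonneg hAl s1
      (fun s hs t ht => g1 s ⟨hs.1, hs.2.trans b1⟩ t ⟨ht.1, ht.2.trans b1⟩) (s2.trans g2.symm)
      (k / l) ⟨by positivity, (div_le_one hl0).2 hkl'⟩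
    rw [s3] at hb
    have e : (k:ℝ) / l * ((A - ε) * l) = (A - ε) * k := by field_simp
    rw [e] at hb
    have hb2 : (k:ℝ) / l * dist (z l) (σ n ((A - ε) * l)) ≤ k / l * (η / 2 * l) :=
      mul_le_mul_of_nonneg_left b2 (by positivity)
    have e' : (k:ℝ) / l * (η / 2 * l) = η / 2 * k := by field_simp
    have := dist_triangle_right (z k) (σ l (k / l * dist y (z l))) (σ n ((A - ε) * k))
    linarith
  · have := g1 0 ⟨le_rfl, dist_nonneg⟩ _ ⟨hAk, a1⟩
    rw [g2, zero_sub, abs_neg, abs_of_nonneg hAk] at this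
    have t := dist_triangle y (z k) (σ n ((A - ε) * k))
    nlinarith

lemma geo_three {Y : Type*} [MetricSpace Y] [CompleteSpace Y] (hbus : BusemannConvex Y)
    (y : Y) (z : ℕ → Y) (A : ℝ) (hA : 0 < A)
    (σ : ℕ → ℝ → Y) (hσ : ∀ n, IsGeodesicFromTo y (z n) (σ n))
    (h1 : ∀ ε > (0:ℝ), ∀ᶠ k : ℕ in atTop, dist y (z k) ≤ (A + ε) * k)
    (h2 : ∀ η > (0:ℝ), ∃ K : ℕ, 1 ≤ K ∧ ∀ k l : ℕ, K ≤ k → k ≤ l → 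
      dist (z k) (σ l (k / l * dist y (z l))) ≤ η * k ∧ (A - η) * k ≤ dist y (z k)) :
    ∃ γ : ℝ → Y, IsGeodesicRay γ ∧ γ 0 = y ∧
      Tendsto (fun n : ℕ => dist (γ (A * n)) (z n) / n) atTop (nhds 0) := by
  have hlen : Tendsto (fun n : ℕ => dist y (z n) / n) atTop (nhds A) := by
    rw [Metric.tendsto_atTop]
    intro ε hε
    obtain ⟨K1, hK1⟩ := eventually_atTop.1 (h1 (ε / 2) (by positivity))
    obtain ⟨K2, hK20, hK2⟩ := h2 (ε / 2) (by positivity)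
    refine ⟨K1 + K2, fun n hn => ?_⟩
    have f1 := hK1 n (by omega)
    have f2 := (hK2 n n (by omega) le_rfl).2
    have hn0 : (0:ℝ) < n := by exact_mod_cast (by omega : 0 < n)
    rw [Real.dist_eq, abs_lt]
    rw [← div_le_iff₀ hn0] at f1
    rw [← le_div_iff₀ hn0] at f2
    constructor <;> linarith
  set P : ℕ → ℝ → Y := fun l s => σ l (s / (A * l) * dist y (z l)) with hP
  have hPd : ∀ (l : ℕ) (s t : ℝ), 0 ≤ s → s ≤ A * l → 0 ≤ t → t ≤ A * l → 0 < l →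
      dist (P l s) (P l t) = |s - t| * (dist y (z l) / l / A) := by
    intro l s t hs hsl ht htl hl
    have hl0 : (0:ℝ) < l := by exact_mod_cast hl
    have hAl : 0 < A * l := by positivity
    have aux : ∀ s, 0 ≤ s → s ≤ A * l → s / (A * l) * dist y (z l) ∈ Icc 0 (dist y (z l)) := by
      intro s hs hsl
      exact ⟨by positivity, mul_le_of_le_one_left dist_nonneg ((div_le_one hAl).2 hsl)⟩
    simp only [hP]
    rw [(hσ l).1 _ (aux s hs hsl) _ (aux t ht htl)]
    have : s / (A * l) * dist y (z l) - t / (A * l) * dist y (z l)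
      = (s - t) * (dist y (z l) / l / A) := by field_simp
    rw [this, abs_mul, abs_of_nonneg (by positivity : 0 ≤ dist y (z l) / l / A)]
  have hPz : ∀ l : ℕ, 0 < l → P l (A * l) = z l := by
    intro l hl
    have hl0 : (0:ℝ) < l := by exact_mod_cast hl
    simp only [hP]
    rw [div_self (by positivity), one_mul, (hσ l).2.2]
  have hcomp : ∀ η > (0:ℝ), ∃ K : ℕ, 1 ≤ K ∧ ∀ k l : ℕ, K ≤ k → k ≤ l → ∀ s, 0 ≤ s → s ≤ A * k →
      dist (P k s) (P l s) ≤ s * η / A := by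
    intro η hη
    obtain ⟨K, hK0, hK⟩ := h2 η hη
    refine ⟨K, hK0, fun k l hk hkl s hs hsk => ?_⟩
    have hk0 : (0:ℝ) < k := by exact_mod_cast (by omega : 0 < k)
    have hl0 : (0:ℝ) < l := by exact_mod_cast (by omega : 0 < l)
    have hkl' : (k:ℝ) ≤ l := by exact_mod_cast hkl
    have f := (hK k l hk hkl).1
    have hle : (k:ℝ) / l * dist y (z l) ≤ dist y (z l) :=
      mul_le_of_le_one_left dist_nonneg ((div_le_one hl0).2 hkl')
    have hb := hbus (dist y (z k)) (k / l * dist y (z l)) (σ k) (σ l) dist_nonneg (by positivity)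
      (hσ k).1 (fun s hs t ht => (hσ l).1 s ⟨hs.1, hs.2.trans hle⟩ t ⟨ht.1, ht.2.trans hle⟩)
      ((hσ k).2.1.trans (hσ l).2.1.symm) (s / (A * k))
      ⟨by positivity, (div_le_one (by positivity)).2 hsk⟩
    rw [(hσ k).2.2] at hb
    have e : s / (A * k) * (k / l * dist y (z l)) = s / (A * l) * dist y (z l) := by field_simp
    rw [e] at hb
    refine hb.trans ((mul_le_mul_of_nonneg_left f (by positivity)).trans (le_of_eq ?_))
    field_simp
  have hlarge : ∀ s : ℝ, ∀ᶠ l : ℕ in atTop, s ≤ A * l := by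
    intro s
    obtain ⟨N, hN⟩ := exists_nat_ge (s / A)
    rw [div_le_iff₀ hA] at hN
    filter_upwards [eventually_ge_atTop N] with l hl
    have : (N:ℝ) ≤ l := by exact_mod_cast hl
    nlinarith
  have hlim : ∀ s : ℝ, ∃ p : Y, 0 ≤ s → Tendsto (fun l => P l s) atTop (nhds p) := by
    intro s
    by_cases hs : 0 ≤ s
    · have hc : CauchySeq (fun l => P l s) := by
        rw [Metric.cauchySeq_iff']
        intro ε hε
        obtain ⟨K, hK0, hK⟩ := hcomp (ε * A / (s + 1)) (by positivity)
        obtain ⟨N, hN⟩ := eventually_atTop.1 (hlarge s)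
        refine ⟨K + N, fun n hn => ?_⟩
        have := hK (K + N) n (by omega) hn s hs (hN _ (by omega))
        rw [dist_comm]
        refine this.trans_lt ?_
        have e : s * (ε * A / (s + 1)) / A = ε * (s / (s + 1)) := by field_simp
        rw [e]
        have : s / (s + 1) < 1 := by rw [div_lt_one (by positivity)]; linarith
        nlinarith
      obtain ⟨p, hp⟩ := cauchySeq_tendsto_of_complete hc
      exact ⟨p, fun _ => hp⟩
    · exact ⟨y, fun h => absurd h hs⟩
  choose γ hγ using hlim
  refine ⟨γ, ?_, ?_, ?_⟩
  · intro s t hs ht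
    have l1 := (hγ s hs).dist (hγ t ht)
    have l2 : Tendsto (fun l : ℕ => |s - t| * (dist y (z l) / l / A)) atTop
        (nhds (|s - t| * (A / A))) := (hlen.div_const A).const_mul _
    rw [div_self hA.ne', mul_one] at l2
    refine tendsto_nhds_unique l1 (l2.congr' ?_)
    filter_upwards [hlarge s, hlarge t, eventually_gt_atTop 0] with l b1 b2 b3
    exact (hPd l s t hs b1 ht b2 b3).symm
  · refine tendsto_nhds_unique (hγ 0 le_rfl) (tendsto_const_nhds.congr fun l => ?_)
    simp [hP, (hσ l).2.1]
  · rw [Metric.tendsto_atTop]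
    intro ε hε
    obtain ⟨K, hK0, hK⟩ := hcomp (ε / 2) (by positivity)
    refine ⟨K, fun n hn => ?_⟩
    have hn0 : (0:ℝ) < n := by exact_mod_cast (by omega : 0 < n)
    have l1 := (hγ (A * n) (by positivity)).dist (tendsto_const_nhds (x := z n))
    have l2 : dist (γ (A * n)) (z n) ≤ ε / 2 * n := by
      refine le_of_tendsto l1 ?_
      filter_upwards [eventually_ge_atTop n] with l hl
      have := hK n l hn hl (A * n) (by positivity) le_rfl
      rw [hPz n (by omega), dist_comm] at this
      refine this.trans (le_of_eq ?_)
      field_simp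
    rw [← div_le_iff₀ hn0] at l2
    rw [Real.dist_eq, sub_zero, abs_of_nonneg (by positivity)]
    linarith

lemma geo_uniq {Y : Type*} [MetricSpace Y] (hbus : BusemannConvex Y)
    (y : Y) (z : ℕ → Y) (A : ℝ) (hA : 0 < A) (γ γ' : ℝ → Y)
    (h : IsGeodesicRay γ ∧ γ 0 = y ∧
      Tendsto (fun n : ℕ => dist (γ (A * n)) (z n) / n) atTop (nhds 0))
    (h' : IsGeodesicRay γ' ∧ γ' 0 = y ∧
      Tendsto (fun n : ℕ => dist (γ' (A * n)) (z n) / n) atTop (nhds 0)) :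
    Set.EqOn γ' γ (Set.Ici 0) := by
  intro s hs
  have hs : 0 ≤ s := hs
  have hsum := ((h'.2.2.add h.2.2).const_mul (s / A))
  rw [add_zero, mul_zero] at hsum
  have : dist (γ' s) (γ s) ≤ 0 := by
    refine ge_of_tendsto hsum ?_
    obtain ⟨N, hN⟩ := exists_nat_ge (s / A)
    rw [div_le_iff₀ hA] at hN
    filter_upwards [eventually_ge_atTop N, eventually_gt_atTop 0] with n hn hn0
    have hn0 : (0:ℝ) < n := by exact_mod_cast hn0
    have hn : (N:ℝ) ≤ n := by exact_mod_cast hn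
    have hsn : s ≤ A * n := by nlinarith
    have hb := hbus (A * n) (A * n) γ' γ (by positivity) (by positivity)
      (fun s hs t ht => h'.1 s t hs.1 ht.1) (fun s hs t ht => h.1 s t hs.1 ht.1)
      (h'.2.1.trans h.2.1.symm) (s / (A * n)) ⟨by positivity, (div_le_one (by positivity)).2 hsn⟩
    rw [div_mul_cancel₀ _ (by positivity : A * n ≠ 0)] at hb
    have t := dist_triangle_right (γ' (A * n)) (γ (A * n)) (z n)
    refine hb.trans ((mul_le_mul_of_nonneg_left t (by positivity)).trans (le_of_eq ?_))
    field_simp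
  exact dist_le_zero.1 this

/-- **Karlsson–Margulis ergodic theorem in weakly uniformly convex spaces**
(Theorem 1.1). If `Y` is a complete Busemann convex geodesic space which is weakly
uniformly convex and satisfies condition (1), and `A > 0`, then for almost every
`x ∈ X` there is a unique geodesic ray `γ` issuing at `y` with
`lim_n d(γ(An), aₙ(x)y)/n = 0`. -/
theorem main_ergodic_theorem
    {Y : Type*} [MetricSpace Y] [CompleteSpace Y]
    (hgeo : GeodesicSpace Y) (hbus : BusemannConvex Y)
    (hwuc : WeaklyUniformlyConvex Y) (hcond : CondOne Y)
    {X : Type*} [MeasurableSpace X] (μ : Measure X) [IsProbabilityMeasure μ]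
    (T : X → X) (hT : Ergodic T μ)
    (D : Set Y) (w : X → Y → Y)
    (hw : ∀ x, Set.MapsTo (w x) D D ∧ LipschitzOnWith 1 (w x) D)
    (y : Y) (hy : y ∈ D)
    (a : ℕ → X → Y → Y) (ha0 : ∀ x, a 0 x = id)
    (harec : ∀ n x, a (n + 1) x = w x ∘ a n (T x))
    (hmeas : ∀ n, Measurable fun x => dist y (a n x y))
    (hint : Integrable (fun x => dist y (a 1 x y)) μ)
    (A : ℝ)
    (hA : Tendsto (fun n : ℕ => (∫ x, dist y (a n x y) ∂μ) / n) atTop (nhds A))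
    (hApos : 0 < A) :
    ∀ᵐ x ∂μ, ∃ γ : ℝ → Y,
      (IsGeodesicRay γ ∧ γ 0 = y ∧
        Tendsto (fun n : ℕ => dist (γ (A * n)) (a n x y) / n) atTop (nhds 0)) ∧
      ∀ γ' : ℝ → Y,
        (IsGeodesicRay γ' ∧ γ' 0 = y ∧
          Tendsto (fun n : ℕ => dist (γ' (A * n)) (a n x y) / n) atTop (nhds 0)) →
        Set.EqOn γ' γ (Set.Ici 0) := by
  have hadd : ∀ k j x, a (k + j) x = a k x ∘ a j (T^[k] x) := by
    intro k
    induction k with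
    | zero => intro j x; simp [ha0]
    | succ k ih =>
      intro j x
      rw [Nat.add_right_comm, harec, harec, ih, Function.iterate_succ_apply, Function.comp_assoc]
  have hmaps : ∀ n x, Set.MapsTo (a n x) D D ∧ LipschitzOnWith 1 (a n x) D := by
    intro n
    induction n with
    | zero =>
      intro x
      rw [ha0]
      exact ⟨Set.mapsTo_id D, LipschitzWith.id.lipschitzOnWith⟩
    | succ n ih =>
      intro x
      rw [harec]
      refine ⟨(hw x).1.comp (ih (T x)).1, ?_⟩
      have := (hw x).2.comp (ih (T x)).2 (ih (T x)).1
      rwa [one_mul] at this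
  have hd : ∀ k j x, dist (a k x y) (a (k + j) x y) ≤ dist y (a j (T^[k] x) y) := by
    intro k j x
    rw [hadd, Function.comp_apply]
    have := (hmaps k x).2.dist_le_mul y hy _ ((hmaps j (T^[k] x)).1 hy)
    simpa using this
  set b : ℕ → X → ℝ := fun n x => dist y (a n x y) with hb
  have hb0 : ∀ x, b 0 x = 0 := by intro x; simp [hb, ha0]
  have hbpos : ∀ n x, 0 ≤ b n x := fun n x => dist_nonneg
  have hsub : ∀ k j x, b (k + j) x ≤ b k x + b j (T^[k] x) := by
    intro k j x
    exact (dist_triangle y (a k x y) _).trans (by linarith [hd k j x])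
  have hbi : ∀ n, Integrable (b n) μ := by
    intro n
    refine (km_int_iter μ T hT.toMeasurePreserving (b 1) hint n).1.mono'
      (hmeas n).aestronglyMeasurable (Eventually.of_forall fun x => ?_)
    rw [Real.norm_of_nonneg (hbpos n x)]
    have := km_sub_le T b hb0 hsub 1 n x
    rwa [one_mul, Function.iterate_one] at this
  have hup : ∀ᵐ x ∂μ, ∀ N : ℕ, ∀ᶠ n : ℕ in atTop, b n x ≤ (A + 1 / ((N:ℝ) + 1)) * n := by
    rw [ae_all_iff]
    intro N
    have : (0:ℝ) < 1 / ((N:ℝ) + 1) := by positivity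
    exact km_upper μ T hT b hmeas hbi hb0 hbpos hsub A _ (by linarith) hApos.le hA
  have hlo : ∀ᵐ x ∂μ, ∀ N : ℕ, ∃ K : ℕ, ∃ᶠ n in atTop, ∀ k : ℕ, K ≤ k → k ≤ n →
      (A - 1 / ((N:ℝ) + 1)) * k ≤ b n x - b (n - k) (T^[k] x) := by
    rw [ae_all_iff]
    intro N
    have : (0:ℝ) < 1 / ((N:ℝ) + 1) := by positivity
    obtain ⟨c0, hc0, hc1⟩ := exists_between (show A - 1 / ((N:ℝ) + 1) < A by linarith)
    refine km_erg μ T hT b hmeas hbi hb0 (fun n x => ?_) _ c0 hc0 ?_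
    · have := hsub 1 n x
      rwa [add_comm 1 n, Function.iterate_one] at this
    · filter_upwards [hA.eventually (lt_mem_nhds hc1), eventually_gt_atTop 0] with n h1 h2
      have hn0 : (0:ℝ) < n := by exact_mod_cast h2
      rw [lt_div_iff₀ hn0] at h1
      exact h1.le
  filter_upwards [hup, hlo] with x hup hlo
  set z : ℕ → Y := fun n => a n x y with hz
  choose σ hσ using fun n => hgeo y (z n)
  have h1 : ∀ ε > (0:ℝ), ∀ᶠ k : ℕ in atTop, dist y (z k) ≤ (A + ε) * k := by
    intro ε hε
    obtain ⟨N, hN⟩ := exists_nat_one_div_lt hε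
    filter_upwards [hup N] with k hk
    exact hk.trans (mul_le_mul_of_nonneg_right (by linarith) (Nat.cast_nonneg k))
  have h2 : ∀ ε > (0:ℝ), ∃ K : ℕ, ∃ᶠ n in atTop, ∀ k : ℕ, K ≤ k → k ≤ n →
      (A - ε) * k ≤ dist y (z n) - dist (z k) (z n) := by
    intro ε hε
    obtain ⟨N, hN⟩ := exists_nat_one_div_lt hε
    obtain ⟨K, hK⟩ := hlo N
    refine ⟨K, hK.mono fun n hn k hk hkn => ?_⟩
    have e1 := hn k hk hkn
    have e2 := hd k (n - k) x
    rw [Nat.add_sub_cancel' hkn] at e2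
    have e3 : (A - ε) * k ≤ (A - 1 / ((N:ℝ) + 1)) * k :=
      mul_le_mul_of_nonneg_right (by linarith) (Nat.cast_nonneg k)
    exact e3.trans (e1.trans (sub_le_sub_left e2 _))
  obtain ⟨γ, hγ⟩ := geo_three hbus y z A hApos σ hσ h1
    (geo_two hbus y z A hApos σ hσ (geo_one hgeo hbus hcond y z A hApos h1 h2 σ hσ))
  exact ⟨γ, hγ, fun γ' hγ' => geo_uniq hbus y z A hApos γ γ' hγ hγ'⟩
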